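/- (Theorem 3: existence of mixed 𝒞-equilibria.) Let T_1,…,T_r be nonempty finite sets and let Π_1,…,Π_r : ∏_{h=1}^r T_h → ℝ be payoff functions. Then there exist probability distributions Λ̄_1,…,Λ̄_r on T_1,…,T_r respectively such that the product Λ̄_1×…×Λ̄_r is a mixed equilibrium: for every ℓ ∈ {1,…,r} and every probability distribution Λ_ℓ on T_ℓ, E_{Λ̄_1×…×Λ̄_{ℓ−1}×Λ_ℓ×Λ̄_{ℓ+1}×…×Λ̄_r}(Π_ℓ) ≤ E_{Λ̄_1×…×Λ̄_r}(Π_ℓ). -/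

import Mathlib

def ScDom {I Y : Type*} (u : I → Y → ℕ) (S : Finset Y) : Prop :=
  ∀ z, ∃ i, ∀ s ∈ S, u i z ≤ u i s

lemma sc_half {I Y : Type*} [Fintype I] [Fintype Y] [DecidableEq I] [DecidableEq Y]
    (u : I → Y → ℕ) (hu : ∀ i, Function.Injective (u i)) (T : Finset Y) (hT : ScDom u T)
    (m : I → Y) (hmT : ∀ i, m i ∈ T) (hm : ∀ i, ∀ t ∈ T, u i (m i) ≤ u i t)
    (p q : I) (hpq : p ≠ q) (hmpq : m p = m q)
    (hinj : ∀ i j, i ≠ p → j ≠ p → m i = m j → i = j)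
    (hA : ∃ z, ∀ j, j ≠ p → u j (m j) < u j z) :
    ∃ a, a ∉ T ∧ (∀ j, j ≠ p → u j (m j) < u j a) ∧ ScDom u (insert a T) ∧
      ∀ y, y ∉ T → ScDom u (insert y T) → u p y < u p (m p) → y = a := by
  classical
  obtain ⟨z0, hz0⟩ := hA
  obtain ⟨a, haA, hamax⟩ := Finset.exists_max_image
    (Finset.univ.filter (fun z => ∀ j, j ≠ p → u j (m j) < u j z)) (u p) ⟨z0, by simpa using hz0⟩
  simp only [Finset.mem_filter, Finset.mem_univ, true_and] at haA hamax
  have hsurj : ∀ t ∈ T, ∃ k, k ≠ p ∧ m k = t := by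
    intro t ht
    obtain ⟨k, hk⟩ := hT t
    have : m k = t := hu k (le_antisymm (hm k t ht) (hk _ (hmT k)))
    by_cases h : k = p
    · exact ⟨q, hpq.symm, by rw [← hmpq, ← h, this]⟩
    · exact ⟨k, h, this⟩
  refine ⟨a, ?_, haA, ?_, ?_⟩
  · intro haT
    obtain ⟨k, hk, rfl⟩ := hsurj a haT
    exact lt_irrefl _ (haA k hk)
  · intro z
    by_cases hz : ∀ j, j ≠ p → u j (m j) < u j z
    · obtain ⟨i, hi⟩ := hT z
      have hip : i = p := by
        by_contra h
        exact absurd (hi _ (hmT i)) (not_le.2 (hz i h))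
      subst hip
      refine ⟨i, fun s hs => ?_⟩
      rcases Finset.mem_insert.1 hs with rfl | hs
      · exact hamax z hz
      · exact hi s hs
    · push Not at hz
      obtain ⟨j, hj, hjz⟩ := hz
      refine ⟨j, fun s hs => ?_⟩
      rcases Finset.mem_insert.1 hs with rfl | hs
      · exact hjz.trans (haA j hj).le
      · exact hjz.trans (hm j s hs)
  · intro y hy hD hyp
    have hyA : ∀ j, j ≠ p → u j (m j) < u j y := by
      intro j hj
      by_contra hlt
      have hne : u j y ≠ u j (m j) := fun h => hy (by rw [hu j h]; exact hmT j)
      have hlt' : u j y < u j (m j) := lt_of_le_of_ne (not_lt.1 hlt) hne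
      obtain ⟨i, hi⟩ := hD (m j)
      have h1 : m i = m j := hu i (le_antisymm (hm i _ (hmT j))
        (hi _ (Finset.mem_insert_of_mem (hmT i))))
      have h2 := hi y (Finset.mem_insert_self _ _)
      rw [← h1] at h2
      have hip : i ≠ p := by
        rintro rfl
        omega
      have := hinj i j hip hj h1
      subst this
      omega
    obtain ⟨i, hi⟩ := hD a
    have hip : i = p := by
      by_contra h
      exact absurd (hi _ (Finset.mem_insert_of_mem (hmT i))) (not_le.2 (haA i h))
    subst hip
    exact hu i (le_antisymm (hamax y hyA) (hi y (Finset.mem_insert_self _ _)))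

lemma sc_two {I Y : Type*} [Fintype I] [Fintype Y] [DecidableEq I] [DecidableEq Y]
    (u : I → Y → ℕ) (hu : ∀ i, Function.Injective (u i))
    (sl : I → Y) (hsl : Function.Injective sl) (hmin : ∀ i y, u i (sl i) ≤ u i y)
    (hbig : ∀ i j, i ≠ j → ∀ y, y ∉ Set.range sl → u i y < u i (sl j))
    (T : Finset Y) (hT : ScDom u T) (hcard : T.card + 1 = Fintype.card I)
    (hx : ∃ t ∈ T, t ∉ Set.range sl) :
    ∃ a b, a ≠ b ∧ a ∉ T ∧ b ∉ T ∧ ∀ y, y ∉ T → (ScDom u (insert y T) ↔ y = a ∨ y = b) := by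
  classical
  obtain ⟨t0, ht0, hns⟩ := hx
  have hex : ∀ i, ∃ x ∈ T, ∀ t ∈ T, u i x ≤ u i t := fun i =>
    Finset.exists_min_image T (u i) ⟨t0, ht0⟩
  choose m hmT hm using hex
  obtain ⟨p, -, q, -, hpq, hmpq⟩ := Finset.exists_ne_map_eq_of_card_lt_of_maps_to
    (s := (Finset.univ : Finset I)) (t := T) (f := m)
    (by rw [Finset.card_univ]; omega) (fun i _ => hmT i)
  have hinj : ∀ p q, p ≠ q → m p = m q → ∀ i j, i ≠ p → j ≠ p → m i = m j → i = j := by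
    intro p q hpq hmpq
    have himg : (Finset.univ.erase p).image m = T := by
      ext t
      simp only [Finset.mem_image, Finset.mem_erase, Finset.mem_univ, and_true]
      constructor
      · rintro ⟨k, -, rfl⟩
        exact hmT k
      · intro ht
        obtain ⟨k, hk⟩ := hT t
        have : m k = t := hu k (le_antisymm (hm k t ht) (hk _ (hmT k)))
        by_cases h : k = p
        · exact ⟨q, hpq.symm, by rw [← hmpq, ← h, this]⟩
        · exact ⟨k, h, this⟩
    have hc : ((Finset.univ.erase p).image m).card = (Finset.univ.erase p).card := by
      rw [himg, Finset.card_erase_of_mem (Finset.mem_univ _), Finset.card_univ]; omega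
    have := Finset.card_image_iff.1 hc
    intro i j hi hj h
    exact this (by simpa using hi) (by simpa using hj) h
  have hA : ∀ p, ∃ z, ∀ j, j ≠ p → u j (m j) < u j z := by
    intro p
    refine ⟨sl p, fun j hj => ?_⟩
    exact (hm j t0 ht0).trans_lt (hbig j p hj t0 hns)
  obtain ⟨a, haT, haA, haD, hau⟩ := sc_half u hu T hT m hmT hm p q hpq hmpq (hinj p q hpq hmpq) (hA p)
  obtain ⟨b, hbT, hbA, hbD, hbu⟩ := sc_half u hu T hT m hmT hm q p hpq.symm hmpq.symm
    (hinj q p hpq.symm hmpq.symm) (hA q)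
  refine ⟨a, b, ?_, haT, hbT, fun y hy => ⟨fun hD => ?_, ?_⟩⟩
  · rintro rfl
    obtain ⟨i, hi⟩ := hT a
    have h1 := hi _ (hmT i)
    by_cases h : i = p
    · exact absurd h1 (not_le.2 (hbA i (by rw [h]; exact hpq)))
    · exact absurd h1 (not_le.2 (haA i h))
  · obtain ⟨i, hi⟩ := hD y
    have h1 : u i y < u i (m i) := lt_of_le_of_ne (hi _ (Finset.mem_insert_of_mem (hmT i)))
      (fun h => hy (by rw [hu i h]; exact hmT i))
    by_cases hip : i = p
    · subst hip; exact Or.inl (hau y hy hD h1)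
    by_cases hiq : i = q
    · subst hiq; exact Or.inr (hbu y hy hD h1)
    exfalso
    obtain ⟨k, hk⟩ := hD (m i)
    have h2 : m k = m i := hu k (le_antisymm (hm k _ (hmT i))
        (hk _ (Finset.mem_insert_of_mem (hmT k))))
    have h3 := hk y (Finset.mem_insert_self _ _)
    by_cases hkp : k = p
    · exact hiq (hinj p q hpq hmpq i q hip hpq.symm (by rw [← h2, hkp, hmpq]))
    · have := hinj p q hpq hmpq k i hkp hip h2
      subst this
      omega
  · rintro (rfl | rfl)
    · exact haD
    · exact hbD

lemma sc_one {I Y : Type*} [Fintype I] [Fintype Y] [DecidableEq I] [DecidableEq Y]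
    (u : I → Y → ℕ) (hu : ∀ i, Function.Injective (u i))
    (sl : I → Y) (hsl : Function.Injective sl) (hmin : ∀ i y, u i (sl i) ≤ u i y)
    (hbig : ∀ i j, i ≠ j → ∀ y, y ∉ Set.range sl → u i y < u i (sl j)) (i0 : I) :
    ∃ a, a ∉ (Finset.univ.erase i0).image sl ∧ ∀ y, y ∉ (Finset.univ.erase i0).image sl →
      (ScDom u (insert y ((Finset.univ.erase i0).image sl)) ↔ y = a) := by
  classical
  set T := (Finset.univ.erase i0).image sl with hTdef
  have hmemT : ∀ y, y ∈ T ↔ ∃ j, j ≠ i0 ∧ sl j = y := by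
    intro y; simp [hTdef]
  have h0 : sl i0 ∉ T := by
    rw [hmemT]; rintro ⟨j, hj, h⟩; exact hj (hsl h)
  obtain ⟨a, haA, hamax⟩ := Finset.exists_max_image
    (Finset.univ.filter (fun z => z ∉ T)) (u i0) ⟨sl i0, by simpa using h0⟩
  simp only [Finset.mem_filter, Finset.mem_univ, true_and] at haA hamax
  refine ⟨a, haA, fun y hy => ⟨fun hD => ?_, ?_⟩⟩
  · obtain ⟨i, hi⟩ := hD a
    have : i = i0 := by
      by_contra h
      have hs : sl i ∈ T := (hmemT _).2 ⟨i, h, rfl⟩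
      have h1 := hi _ (Finset.mem_insert_of_mem hs)
      have := hu i (le_antisymm h1 (hmin i a))
      exact haA (this ▸ hs)
    subst this
    exact hu i (le_antisymm (hamax y hy) (hi y (Finset.mem_insert_self _ _)))
  · rintro rfl z
    by_cases hz : z ∈ T
    · obtain ⟨j, hj, rfl⟩ := (hmemT _).1 hz
      exact ⟨j, fun s _ => hmin j s⟩
    · refine ⟨i0, fun s hs => ?_⟩
      rcases Finset.mem_insert.1 hs with rfl | hs
      · exact hamax z hz
      · obtain ⟨j, hj, rfl⟩ := (hmemT _).1 hs
        by_cases hr : z ∈ Set.range sl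
        · obtain ⟨k, rfl⟩ := hr
          by_cases hk : k = i0
          · subst hk; exact hmin _ _
          · exact absurd ((hmemT _).2 ⟨k, hk, rfl⟩) hz
        · exact (hbig i0 j hj.symm z hr).le

lemma sc_room {I Y : Type*} [Fintype I] [Fintype Y] [DecidableEq I] [DecidableEq Y]
    (c : Y → I) (i0 : I) (S : Finset Y) (hS : S.card = Fintype.card I)
    (hc : S.image c ≠ Finset.univ) (D : Finset (Finset Y))
    (hD : ∀ T, T ∈ D ↔ T ⊆ S ∧ T.card + 1 = Fintype.card I ∧ T.image c = Finset.univ.erase i0) :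
    Even D.card := by
  classical
  rcases D.eq_empty_or_nonempty with h | ⟨T0, hT0⟩
  · simp [h]
  obtain ⟨hsub, hcard, himg⟩ := (hD T0).1 hT0
  have herase : ∀ T, T ⊆ S → T.card + 1 = Fintype.card I → ∃ y ∈ S, T = S.erase y := by
    intro T hTS hTc
    have h1 : (S \ T).card = 1 := by
      rw [Finset.card_sdiff_of_subset hTS]; omega
    obtain ⟨y, hy⟩ := Finset.card_eq_one.1 h1
    have hyS : y ∈ S \ T := by rw [hy]; simp
    refine ⟨y, (Finset.mem_sdiff.1 hyS).1, ?_⟩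
    rw [Finset.erase_eq, ← hy, Finset.sdiff_sdiff_eq_self hTS]
  obtain ⟨x, hxS, rfl⟩ := herase T0 hsub hcard
  have hinj : Set.InjOn c (S.erase x : Finset Y) := by
    apply Finset.card_image_iff.1
    rw [himg, Finset.card_erase_of_mem (Finset.mem_univ _), Finset.card_univ]; omega
  have hcx : c x ≠ i0 := by
    intro h
    apply hc
    rw [← Finset.insert_erase hxS, Finset.image_insert, himg, h,
      Finset.insert_erase (Finset.mem_univ _)]
  have : c x ∈ (S.erase x).image c := by rw [himg]; simpa using hcx
  obtain ⟨x', hx', hcx'⟩ := Finset.mem_image.1 this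
  have hx'2 := Finset.mem_erase.1 hx'
  have : D = {S.erase x, S.erase x'} := by
    ext T
    simp only [Finset.mem_insert, Finset.mem_singleton]
    constructor
    · intro hT
      obtain ⟨a1, a2, a3⟩ := (hD T).1 hT
      obtain ⟨y, hy, rfl⟩ := herase T a1 a2
      by_cases hyx : y = x
      · left; rw [hyx]
      right
      have hy0 : y ∈ S.erase x := Finset.mem_erase.2 ⟨hyx, hy⟩
      have : c y ∈ (S.erase y).image c := by
        rw [a3, ← himg]; exact Finset.mem_image_of_mem c hy0
      obtain ⟨w, hw, hcw⟩ := Finset.mem_image.1 this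
      have hw2 := Finset.mem_erase.1 hw
      by_cases hwx : w = x
      · subst hwx
        rw [hinj hy0 hx' (by rw [hcx', hcw])]
      · exact absurd (hinj (Finset.mem_erase.2 ⟨hwx, hw2.2⟩) hy0 hcw) hw2.1
    · rintro (rfl | rfl)
      · exact hT0
      · refine (hD _).2 ⟨Finset.erase_subset _ _, ?_, ?_⟩
        · rw [Finset.card_erase_of_mem hx'2.2, ← hcard, Finset.card_erase_of_mem hxS]
        · rw [← himg]
          ext i
          simp only [Finset.mem_image, Finset.mem_erase]
          constructor
          · rintro ⟨w, ⟨h1, h2⟩, rfl⟩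
            by_cases hwx : w = x
            · subst hwx; exact ⟨x', hx'2, hcx'⟩
            · exact ⟨w, ⟨hwx, h2⟩, rfl⟩
          · rintro ⟨w, ⟨h1, h2⟩, rfl⟩
            by_cases hwx : w = x'
            · subst hwx; exact ⟨x, ⟨hx'2.1.symm, hxS⟩, hcx'.symm⟩
            · exact ⟨w, ⟨hwx, h2⟩, rfl⟩
  rw [this, Finset.card_pair]
  · exact ⟨1, rfl⟩
  · intro h
    exact (Finset.notMem_erase x S) (h ▸ Finset.mem_erase.2 ⟨hx'2.1.symm, hxS⟩)

lemma sc_main {I Y : Type*} [Fintype I] [Fintype Y] [DecidableEq I] [DecidableEq Y]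
    (u : I → Y → ℕ) (hu : ∀ i, Function.Injective (u i))
    (sl : I → Y) (hsl : Function.Injective sl) (hmin : ∀ i y, u i (sl i) ≤ u i y)
    (hbig : ∀ i j, i ≠ j → ∀ y, y ∉ Set.range sl → u i y < u i (sl j)) (i0 : I)
    (c : Y → I) (hcsl : ∀ i, c (sl i) = i) :
    ∃ S : Finset Y, ScDom u S ∧ S.image c = Finset.univ := by
  classical
  by_contra hno
  push Not at hno
  set R : Finset (Finset Y) :=
    Finset.univ.filter (fun S => ScDom u S ∧ S.card = Fintype.card I) with hR
  set D : Finset (Finset Y) := Finset.univ.filter (fun T => ScDom u T ∧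
    T.card + 1 = Fintype.card I ∧ T.image c = Finset.univ.erase i0) with hD
  have hsum := Finset.sum_card_bipartiteAbove_eq_sum_card_bipartiteBelow (s := D) (t := R)
    (fun T S => T ⊆ S)
  have hmono : ∀ S T : Finset Y, T ⊆ S → ScDom u S → ScDom u T := by
    intro S T h hS z
    obtain ⟨i, hi⟩ := hS z
    exact ⟨i, fun s hs => hi s (h hs)⟩
  have hright : Even (∑ S ∈ R, (D.bipartiteBelow (fun T S => T ⊆ S) S).card) := by
    apply Finset.even_sum
    intro S hS
    simp only [hR, Finset.mem_filter, Finset.mem_univ, true_and] at hS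
    apply sc_room c i0 S hS.2 (hno S hS.1)
    intro T
    simp only [Finset.bipartiteBelow, hD, Finset.mem_filter, Finset.mem_univ, true_and]
    constructor
    · rintro ⟨⟨_, h2, h3⟩, h4⟩; exact ⟨h4, h2, h3⟩
    · rintro ⟨h4, h2, h3⟩; exact ⟨⟨hmono _ _ h4 hS.1, h2, h3⟩, h4⟩
  have hroom : ∀ T, T.card + 1 = Fintype.card I → ∀ S,
      S ∈ R.filter (fun S => T ⊆ S) ↔ ∃ y, y ∉ T ∧ S = insert y T ∧ ScDom u (insert y T) := by
    intro T hTc S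
    simp only [hR, Finset.mem_filter, Finset.mem_univ, true_and]
    constructor
    · rintro ⟨⟨h1, h2⟩, h3⟩
      have h4 : (S \ T).card = 1 := by
        rw [Finset.card_sdiff_of_subset h3]; omega
      obtain ⟨y, hy⟩ := Finset.card_eq_one.1 h4
      have hyS : y ∈ S \ T := by rw [hy]; simp
      have : S = insert y T := by
        rw [Finset.insert_eq, ← hy, Finset.sdiff_union_of_subset h3]
      exact ⟨y, (Finset.mem_sdiff.1 hyS).2, this, this ▸ h1⟩
    · rintro ⟨y, hy, rfl, h⟩
      exact ⟨⟨h, by rw [Finset.card_insert_of_notMem hy, hTc]⟩, Finset.subset_insert _ _⟩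
  set T0 := (Finset.univ.erase i0).image sl with hT0
  obtain ⟨a, haT, ha⟩ := sc_one u hu sl hsl hmin hbig i0
  rw [← hT0] at haT ha
  have hT0c : T0.card + 1 = Fintype.card I := by
    rw [hT0, Finset.card_image_of_injective _ hsl, Finset.card_erase_of_mem (Finset.mem_univ _),
      Finset.card_univ]
    have : 0 < Fintype.card I := Fintype.card_pos_iff.2 ⟨i0⟩
    omega
  have hT0D : T0 ∈ D := by
    simp only [hD, Finset.mem_filter, Finset.mem_univ, true_and]
    refine ⟨hmono _ _ (Finset.subset_insert a T0) ((ha a haT).2 rfl), hT0c, ?_⟩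
    rw [hT0, Finset.image_image]
    ext i
    simp [hcsl]
  have h1 : (R.bipartiteAbove (fun T S => T ⊆ S) T0).card = 1 := by
    rw [Finset.card_eq_one]
    refine ⟨insert a T0, ?_⟩
    ext S
    rw [Finset.bipartiteAbove, hroom T0 hT0c, Finset.mem_singleton]
    constructor
    · rintro ⟨y, hy, rfl, h⟩
      rw [(ha y hy).1 h]
    · rintro rfl
      exact ⟨a, haT, rfl, (ha a haT).2 rfl⟩
  have hleft : Even (∑ T ∈ D.erase T0, (R.bipartiteAbove (fun T S => T ⊆ S) T).card) := by
    apply Finset.even_sum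
    intro T hT
    rw [Finset.mem_erase] at hT
    obtain ⟨hne, hT⟩ := hT
    simp only [hD, Finset.mem_filter, Finset.mem_univ, true_and] at hT
    obtain ⟨hTd, hTc, hTi⟩ := hT
    have hx : ∃ t ∈ T, t ∉ Set.range sl := by
      by_contra hcon
      push Not at hcon
      apply hne
      apply Finset.eq_of_subset_of_card_le
      · intro t ht
        obtain ⟨i, rfl⟩ := hcon t ht
        have : c (sl i) ∈ T.image c := Finset.mem_image_of_mem c ht
        rw [hTi, hcsl] at this
        exact Finset.mem_image_of_mem sl this
      · omega
    obtain ⟨a, b, hab, haT, hbT, hy⟩ := sc_two u hu sl hsl hmin hbig T hTd hTc hx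
    have : R.bipartiteAbove (fun T S => T ⊆ S) T = {insert a T, insert b T} := by
      ext S
      rw [Finset.bipartiteAbove, hroom T hTc, Finset.mem_insert, Finset.mem_singleton]
      constructor
      · rintro ⟨y, hy', rfl, h⟩
        rcases (hy y hy').1 h with rfl | rfl
        · left; rfl
        · right; rfl
      · rintro (rfl | rfl)
        · exact ⟨a, haT, rfl, (hy a haT).2 (Or.inl rfl)⟩
        · exact ⟨b, hbT, rfl, (hy b hbT).2 (Or.inr rfl)⟩
    rw [this, Finset.card_pair]
    · exact ⟨1, rfl⟩
    · intro h
      have : a ∈ insert b T := h ▸ Finset.mem_insert_self a T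
      rcases Finset.mem_insert.1 this with h | h
      · exact hab h
      · exact haT h
  rw [← Finset.add_sum_erase D _ hT0D, h1] at hsum
  rw [← hsum] at hright
  rw [Nat.even_add] at hright
  exact absurd (hright.2 hleft) (by decide)

lemma br_grid {I : Type*} [Fintype I] [DecidableEq I] [Nonempty I] (N : ℕ) (m : I → ℕ)
    (h : ∑ i, m i ≤ N) : ∃ y : I → Fin (N + 1), ∑ i, (y i : ℕ) = N ∧ ∀ i, m i ≤ y i := by
  obtain ⟨i0⟩ := ‹Nonempty I›
  let y : I → ℕ := fun i => m i + if i = i0 then N - ∑ i, m i else 0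
  have hs : ∑ i, y i = N := by
    simp only [y, Finset.sum_add_distrib, Finset.sum_ite_eq', Finset.mem_univ, if_true]
    omega
  have hle : ∀ i, y i < N + 1 := fun i => by
    have := Finset.single_le_sum (f := y) (fun i _ => Nat.zero_le _) (Finset.mem_univ i)
    omega
  exact ⟨fun i => ⟨y i, hle i⟩, hs, fun i => Nat.le_add_right _ _⟩

lemma br_approx {I : Type*} [Fintype I] [DecidableEq I] [Nonempty I] (f : (I → ℝ) → (I → ℝ))
    (hf : ∀ x ∈ stdSimplex ℝ I, f x ∈ stdSimplex ℝ I) (N : ℕ) (hN : 0 < N) :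
    ∃ p ∈ stdSimplex ℝ I, ∃ q : I → I → ℝ, ∀ i, q i ∈ stdSimplex ℝ I ∧
      (∀ j, |q i j - p j| ≤ (Fintype.card I : ℝ) / N) ∧
      q i i ≤ f (q i) i + (Fintype.card I : ℝ) / N := by
  classical
  let X := {x : I → Fin (N + 1) // ∑ i, (x i : ℕ) = N}
  have hNR : (0 : ℝ) < N := by exact_mod_cast hN
  let g : X → I → ℝ := fun x i => ((x.1 i : ℕ) : ℝ) / N
  have hg : ∀ x, g x ∈ stdSimplex ℝ I := by
    intro x
    refine ⟨fun i => by positivity, ?_⟩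
    simp only [g]
    rw [← Finset.sum_div, ← Nat.cast_sum, x.2, div_self hNR.ne']
  have hcol : ∀ x : X, ∃ i, g x i ≤ f (g x) i := by
    intro x
    by_contra hcon
    push Not at hcon
    have h1 := Finset.sum_lt_sum_of_nonempty (s := (Finset.univ : Finset I))
      Finset.univ_nonempty (fun i _ => hcon i)
    rw [(hg x).2, (hf _ (hg x)).2] at h1
    exact lt_irrefl _ h1
  choose col hcol using hcol
  let K := Fintype.card X
  let e : X ≃ Fin K := Fintype.equivFin X
  let e' : I ≃ Fin (Fintype.card I) := Fintype.equivFin I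
  let u : I → X ⊕ I → ℕ := fun i => Sum.elim (fun x => 1 + (x.1 i : ℕ) * K + e x)
    (fun j => if j = i then 0 else 1 + (N + 1) * K + e' j)
  have hul : ∀ i x, u i (Sum.inl x) = 1 + (x.1 i : ℕ) * K + e x := fun _ _ => rfl
  have hur : ∀ i j, u i (Sum.inr j) = if j = i then 0 else 1 + (N + 1) * K + e' j :=
    fun _ _ => rfl
  have hle : ∀ i x y, u i (Sum.inl x) ≤ u i (Sum.inl y) → (x.1 i : ℕ) ≤ y.1 i := by
    intro i x y h
    by_contra hlt
    have h1 : ((y.1 i : ℕ) + 1) * K ≤ (x.1 i : ℕ) * K := Nat.mul_le_mul_right _ (by omega)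
    have h2 := (e y).2
    rw [hul, hul] at h
    rw [add_mul] at h1
    omega
  have hlt : ∀ i x, u i (Sum.inl x) < 1 + (N + 1) * K := by
    intro i x
    have h1 : ((x.1 i : ℕ) + 1) * K ≤ (N + 1) * K := Nat.mul_le_mul_right _ (x.1 i).2
    have h2 := (e x).2
    rw [hul]
    rw [add_mul] at h1
    omega
  have hu : ∀ i, Function.Injective (u i) := by
    rintro i (x | j) (y | k) h
    · have h1 := le_antisymm (hle i x y h.le) (hle i y x h.ge)
      rw [hul, hul, h1] at h
      have : e x = e y := Fin.ext (by omega)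
      rw [e.injective this]
    · exfalso
      have h1 := hlt i x
      have h2 := hul i x
      rw [hur] at h
      split_ifs at h <;> omega
    · exfalso
      have h1 := hlt i y
      have h2 := hul i y
      rw [hur] at h
      split_ifs at h <;> omega
    · rw [hur, hur] at h
      split_ifs at h with h1 h2 h2
      · rw [h1, h2]
      · omega
      · omega
      · have : e' j = e' k := Fin.ext (by omega)
        rw [e'.injective this]
  obtain ⟨S, hSd, hSc⟩ := sc_main u hu Sum.inr Sum.inr_injective
    (by intro i y; rw [hur]; simp)
    (by
      rintro i j hij (x | k) hy
      · have := hlt i x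
        rw [hur, if_neg hij.symm]
        omega
      · exact absurd ⟨k, rfl⟩ hy) (Classical.arbitrary I) (Sum.elim col id) (fun _ => rfl)
  have hdom : ∀ y : X, ∃ i, Sum.inr i ∉ S ∧ ∀ x, Sum.inl x ∈ S → (y.1 i : ℕ) ≤ x.1 i := by
    intro y
    obtain ⟨i, hi⟩ := hSd (Sum.inl y)
    refine ⟨i, fun h => ?_, fun x hx => hle i y x (hi _ hx)⟩
    have := hi _ h
    rw [hur, if_pos rfl, hul] at this
    omega
  have hcolS : ∀ i, Sum.inr i ∈ S ∨ ∃ x, Sum.inl x ∈ S ∧ col x = i := by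
    intro i
    have : i ∈ S.image (Sum.elim col id) := by rw [hSc]; exact Finset.mem_univ _
    obtain ⟨s, hs, rfl⟩ := Finset.mem_image.1 this
    rcases s with x | j
    · exact Or.inr ⟨x, hs, rfl⟩
    · exact Or.inl hs
  have hne : ∃ x0, Sum.inl x0 ∈ S := by
    obtain ⟨y, hy, -⟩ := br_grid (I := I) N (fun _ => 0) (by simp)
    obtain ⟨i, hi, -⟩ := hdom ⟨y, hy⟩
    rcases hcolS i with h | ⟨x, hx, -⟩
    · exact absurd h hi
    · exact ⟨x, hx⟩
  have hm : ∀ i, ∃ k : ℕ, (∀ x, Sum.inl x ∈ S → k ≤ (x.1 i : ℕ)) ∧ (Sum.inr i ∈ S → k = 0) ∧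
      (Sum.inr i ∉ S → ∃ x, Sum.inl x ∈ S ∧ k = (x.1 i : ℕ)) := by
    intro i
    by_cases hi : Sum.inr i ∈ S
    · exact ⟨0, fun _ _ => Nat.zero_le _, fun _ => rfl, fun h => absurd hi h⟩
    · obtain ⟨x0, hx0⟩ := hne
      obtain ⟨x, hx, hmin⟩ := Finset.exists_min_image (Finset.univ.filter (fun x : X => Sum.inl x ∈ S))
        (fun x => (x.1 i : ℕ)) ⟨x0, by simpa using hx0⟩
      simp only [Finset.mem_filter, Finset.mem_univ, true_and] at hx hmin
      exact ⟨x.1 i, hmin, fun h => absurd h hi, fun _ => ⟨x, hx, rfl⟩⟩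
  choose m hm1 hm2 hm3 using hm
  have hsum : N < ∑ i, (m i + 1) := by
    by_contra hcon
    obtain ⟨y, hy, hym⟩ := br_grid (I := I) N (fun i => m i + 1) (not_lt.1 hcon)
    obtain ⟨i, hi, hi2⟩ := hdom ⟨y, hy⟩
    obtain ⟨x, hx, hmx⟩ := hm3 i hi
    have h1 := hi2 x hx
    have h2 := hym i
    simp only at h1 h2
    omega
  have hup : ∀ x, Sum.inl x ∈ S → ∀ i, (x.1 i : ℕ) ≤ m i + Fintype.card I := by
    intro x hx i
    have h1 : ∑ j, (x.1 j : ℕ) = ∑ j, ((x.1 j : ℕ) - m j) + ∑ j, m j := by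
      rw [← Finset.sum_add_distrib]
      exact Finset.sum_congr rfl (fun j _ => by have := hm1 j x hx; omega)
    have h2 := Finset.single_le_sum (f := fun j => (x.1 j : ℕ) - m j)
      (fun i _ => Nat.zero_le _) (Finset.mem_univ i)
    rw [Finset.sum_add_distrib] at hsum
    simp only [Finset.sum_const, Finset.card_univ, smul_eq_mul, mul_one] at hsum
    have h3 := x.2
    omega
  have hclose : ∀ x y, Sum.inl x ∈ S → Sum.inl y ∈ S → ∀ j,
      |g x j - g y j| ≤ (Fintype.card I : ℝ) / N := by
    intro x y hx hy j
    simp only [g]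
    rw [← sub_div, abs_div, abs_of_pos hNR]
    gcongr
    have a1 : ((x.1 j : ℕ) : ℝ) ≤ m j + Fintype.card I := by exact_mod_cast hup x hx j
    have a2 : ((y.1 j : ℕ) : ℝ) ≤ m j + Fintype.card I := by exact_mod_cast hup y hy j
    have a3 : (m j : ℝ) ≤ ((x.1 j : ℕ) : ℝ) := by exact_mod_cast hm1 j x hx
    have a4 : (m j : ℝ) ≤ ((y.1 j : ℕ) : ℝ) := by exact_mod_cast hm1 j y hy
    rw [abs_le]
    constructor <;> linarith
  obtain ⟨x0, hx0⟩ := hne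
  have hq : ∀ i, ∃ x, Sum.inl x ∈ S ∧ g x i ≤ f (g x) i + (Fintype.card I : ℝ) / N := by
    intro i
    rcases hcolS i with h | ⟨x, hx, rfl⟩
    · refine ⟨x0, hx0, ?_⟩
      have h1 := hup x0 hx0 i
      rw [hm2 i h, zero_add] at h1
      have h2 : g x0 i ≤ (Fintype.card I : ℝ) / N := by
        simp only [g]
        gcongr
      have h3 := (hf _ (hg x0)).1 i
      linarith
    · refine ⟨x, hx, ?_⟩
      have := hcol x
      have h2 : (0 : ℝ) ≤ (Fintype.card I : ℝ) / N := by positivity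
      linarith
  choose x hxS hx using hq
  exact ⟨g x0, hg x0, fun i => g (x i), fun i => ⟨hg _, hclose _ _ (hxS i) hx0, hx i⟩⟩

lemma br_fixed {I : Type*} [Fintype I] [Nonempty I] (f : (I → ℝ) → (I → ℝ))
    (hf : ∀ x ∈ stdSimplex ℝ I, f x ∈ stdSimplex ℝ I) (hc : Continuous f) :
    ∃ x ∈ stdSimplex ℝ I, f x = x := by
  classical
  choose p hp q hq using fun N : ℕ => br_approx f hf (N + 1) (Nat.succ_pos N)
  obtain ⟨x, hx, φ, hφ, hlim⟩ := (isCompact_stdSimplex ℝ I).tendsto_subseq hp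
  have hz : Filter.Tendsto (fun N : ℕ => (Fintype.card I : ℝ) / ((φ N + 1 : ℕ) : ℝ))
      Filter.atTop (nhds 0) := by
    have h1 : Filter.Tendsto (fun N : ℕ => (Fintype.card I : ℝ) / ((N : ℕ) : ℝ))
      Filter.atTop (nhds 0) := tendsto_const_div_atTop_nhds_zero_nat _
    exact h1.comp ((Filter.tendsto_add_atTop_nat 1).comp hφ.tendsto_atTop)
  have hql : ∀ i, Filter.Tendsto (fun N => q (φ N) i) Filter.atTop (nhds x) := by
    intro i
    rw [tendsto_pi_nhds]
    intro j
    have h1 : Filter.Tendsto (fun N => q (φ N) i j - p (φ N) j) Filter.atTop (nhds 0) :=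
      squeeze_zero_norm (fun N => (hq (φ N) i).2.1 j) hz
    have h2 := (tendsto_pi_nhds.1 hlim j)
    have h3 := h1.add h2
    simpa using h3
  have hle : ∀ i, x i ≤ f x i := by
    intro i
    have h1 := tendsto_pi_nhds.1 (hql i) i
    have h2 := tendsto_pi_nhds.1 ((hc.tendsto x).comp (hql i)) i
    have h3 := h2.add hz
    rw [add_zero] at h3
    exact le_of_tendsto_of_tendsto' h1 h3 (fun N => (hq (φ N) i).2.2)
  refine ⟨x, hx, ?_⟩
  have heq : ∑ i, x i = ∑ i, f x i := by rw [hx.2, (hf x hx).2]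
  funext i
  exact ((Finset.sum_eq_sum_iff_of_le (fun i _ => hle i)).1 heq i (Finset.mem_univ i)).symm

/-- value for player `l` of the pure strategy `x` against `Λ` -/
noncomputable def nashV {r : ℕ} {T : Fin r → Type*} [∀ h, Fintype (T h)]
    (P : Fin r → (∀ h, T h) → ℝ) (Λ : ∀ h, T h → ℝ) (l : Fin r) (x : T l) : ℝ :=
  open Classical in
  ∑ s : ∀ h, T h, P l s * ((if s l = x then 1 else 0) * ∏ h ∈ Finset.univ.erase l, Λ h (s h))

lemma nash_lin {r : ℕ} {T : Fin r → Type*} [∀ h, Fintype (T h)]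
    (P : Fin r → (∀ h, T h) → ℝ) (Λ : ∀ h, T h → ℝ) (l : Fin r) (Λ' : T l → ℝ) :
    (∑ s : ∀ h, T h, P l s * ∏ h, Function.update Λ l Λ' h (s h)) =
      ∑ x, Λ' x * nashV P Λ l x := by
  classical
  simp only [nashV, Finset.mul_sum]
  rw [Finset.sum_comm]
  refine Finset.sum_congr rfl (fun s _ => ?_)
  rw [Finset.sum_eq_single (s l)]
  · rw [← Finset.mul_prod_erase _ _ (Finset.mem_univ l), Function.update_self, if_pos rfl]
    have : ∏ h ∈ Finset.univ.erase l, Function.update Λ l Λ' h (s h) =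
        ∏ h ∈ Finset.univ.erase l, Λ h (s h) :=
      Finset.prod_congr rfl (fun h hh => by
        rw [Function.update_of_ne (Finset.ne_of_mem_erase hh)])
    rw [this]
    ring
  · intro x _ hx
    rw [if_neg hx.symm]
    ring
  · intro h
    exact absurd (Finset.mem_univ _) h

lemma nash_fix {X : Type*} [Fintype X] (L V : X → ℝ) (hL : ∑ x, L x = 1)
    (h : ∀ x, L x = (L x + max 0 (V x - ∑ y, L y * V y)) /
      (1 + ∑ z, max 0 (V z - ∑ y, L y * V y))) (x : X) : V x ≤ ∑ y, L y * V y := by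
  set W := ∑ y, L y * V y with hW
  set G : X → ℝ := fun x => max 0 (V x - W) with hG
  have hG0 : ∀ x, 0 ≤ G x := fun x => le_max_left _ _
  have hS0 : 0 ≤ ∑ z, G z := Finset.sum_nonneg (fun z _ => hG0 z)
  have h1 : ∀ x, L x * ∑ z, G z = G x := by
    intro x
    have h2 : L x = (L x + G x) / (1 + ∑ z, G z) := h x
    have h3 : (1 + ∑ z, G z) ≠ 0 := by positivity
    rw [eq_div_iff h3] at h2
    linarith
  have h2 : ∑ x, L x * (V x - W) = 0 := by
    simp only [mul_sub, Finset.sum_sub_distrib]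
    rw [← Finset.sum_mul, hL, ← hW]
    ring
  have h3 : ∑ x, G x * G x = 0 := by
    have : ∑ x, G x * G x = (∑ z, G z) * ∑ x, L x * (V x - W) := by
      rw [Finset.mul_sum]
      refine Finset.sum_congr rfl (fun x _ => ?_)
      have : G x * G x = G x * (V x - W) := by
        simp only [hG]
        rcases le_total 0 (V x - W) with h | h
        · rw [max_eq_right h]
        · rw [max_eq_left h]; ring
      rw [this]
      nth_rewrite 1 [← h1 x]
      ring
    rw [this, h2, mul_zero]
  have h4 := (Finset.sum_eq_zero_iff_of_nonneg (fun x _ => mul_self_nonneg (G x))).1 h3 x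
    (Finset.mem_univ x)
  have h5 : G x = 0 := mul_self_eq_zero.1 h4
  have h6 : V x - W ≤ G x := le_max_right _ _
  linarith

/-- Theorem 3: existence of mixed 𝒞-equilibria.  For finitely many
coalitions with nonempty finite strategy sets `T h` and payoffs `Payoff h`, there is a
profile of mixed strategies `Λ` whose product is a mixed equilibrium: no coalition
can improve its expected payoff by a unilateral change of its mixed strategy. -/
theorem stmt_4 {r : ℕ} (T : Fin r → Type*) [∀ h, Fintype (T h)] [∀ h, Nonempty (T h)]
    (Payoff : Fin r → (∀ h, T h) → ℝ) :
    ∃ Λ : ∀ h, T h → ℝ,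
      (∀ h, (∀ x, 0 ≤ Λ h x) ∧ (∑ x, Λ h x) = 1) ∧
      ∀ ℓ : Fin r, ∀ Λ' : T ℓ → ℝ, (∀ x, 0 ≤ Λ' x) → (∑ x, Λ' x) = 1 →
        (∑ s : ∀ h, T h, Payoff ℓ s * ∏ h, Function.update Λ ℓ Λ' h (s h)) ≤
          ∑ s : ∀ h, T h, Payoff ℓ s * ∏ h, Λ h (s h) := by
  classical
  rcases Nat.eq_zero_or_pos r with hr | hr
  · subst hr
    exact ⟨fun h => h.elim0, fun h => h.elim0, fun h => h.elim0⟩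
  have hrR : (0 : ℝ) < r := by exact_mod_cast hr
  have : Nonempty (Σ h, T h) := ⟨⟨⟨0, hr⟩, Classical.arbitrary _⟩⟩
  let S : ((Σ h, T h) → ℝ) → Fin r → ℝ := fun z h => r * ∑ x, z ⟨h, x⟩
  let lam : ((Σ h, T h) → ℝ) → ∀ h, T h → ℝ := fun z h x =>
    (r * z ⟨h, x⟩ + max 0 (1 - S z h) / Fintype.card (T h)) / max (S z h) 1
  have hlamc : ∀ h x, Continuous (fun z => lam z h x) := by
    intro h x
    have hS : Continuous (fun z => S z h) := by simp only [S]; fun_prop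
    refine Continuous.div ?_ ?_ (fun z => ?_)
    · fun_prop
    · fun_prop
    · have : (1 : ℝ) ≤ max (S z h) 1 := le_max_right _ _
      positivity
  have hlam1 : ∀ z h, ∑ x, lam z h x = 1 := by
    intro z h
    simp only [lam]
    rw [← Finset.sum_div, Finset.sum_add_distrib, ← Finset.mul_sum]
    have hc : (Fintype.card (T h) : ℝ) ≠ 0 := by simp
    rw [Finset.sum_const, Finset.card_univ, nsmul_eq_mul, mul_div_cancel₀ _ hc]
    change (S z h + _) / _ = _
    rcases le_total (S z h) 1 with h1 | h1
    · rw [max_eq_right (by linarith : 0 ≤ 1 - S z h), max_eq_right h1]; ring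
    · rw [max_eq_left (by linarith : 1 - S z h ≤ 0), max_eq_left h1, add_zero, div_self]
      linarith
  have hlam0 : ∀ z ∈ stdSimplex ℝ (Σ h, T h), ∀ h x, 0 ≤ lam z h x := by
    intro z hz h x
    have h1 := hz.1 ⟨h, x⟩
    have h2 : (1 : ℝ) ≤ max (S z h) 1 := le_max_right _ _
    simp only [lam]
    positivity
  let V : ((Σ h, T h) → ℝ) → ∀ h, T h → ℝ := fun z h x => nashV Payoff (lam z) h x
  have hVc : ∀ h x, Continuous (fun z => V z h x) := by
    intro h x
    simp only [V, nashV]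
    fun_prop
  let G : ((Σ h, T h) → ℝ) → ∀ h, T h → ℝ := fun z h x =>
    max 0 (V z h x - ∑ y, lam z h y * V z h y)
  have hGc : ∀ h x, Continuous (fun z => G z h x) := by
    intro h x
    simp only [G]
    fun_prop
  have hG0 : ∀ z h x, 0 ≤ G z h x := fun z h x => le_max_left _ _
  have hden : ∀ z h, 0 < 1 + ∑ y, G z h y := fun z h => by
    have : 0 ≤ ∑ y, G z h y := Finset.sum_nonneg (fun y _ => hG0 z h y)
    linarith
  let F0 : ((Σ h, T h) → ℝ) → ∀ h, T h → ℝ := fun z h x =>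
    (lam z h x + G z h x) / (1 + ∑ y, G z h y)
  have hF1 : ∀ z h, ∑ x, F0 z h x = 1 := by
    intro z h
    simp only [F0]
    rw [← Finset.sum_div, Finset.sum_add_distrib, hlam1, div_self (hden z h).ne']
  have hF0c : ∀ h x, Continuous (fun z => F0 z h x) := by
    intro h x
    refine Continuous.div ?_ ?_ (fun z => (hden z h).ne')
    · fun_prop
    · fun_prop
  obtain ⟨z, hz, hfix⟩ := br_fixed (I := Σ h, T h) (fun z a => F0 z a.1 a.2 / r)
    (by
      intro z hz
      refine ⟨fun a => ?_, ?_⟩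
      · have h1 := hlam0 z hz a.1 a.2
        have h2 := hG0 z a.1 a.2
        have h3 := hden z a.1
        simp only [F0]
        positivity
      · rw [← Finset.sum_div, Fintype.sum_sigma]
        simp only [hF1]
        simp [hrR.ne'])
    (by
      refine continuous_pi (fun a => ?_)
      exact (hF0c a.1 a.2).div_const _)
  have hfix' : ∀ h x, r * z ⟨h, x⟩ = F0 z h x := by
    intro h x
    have := congrFun hfix ⟨h, x⟩
    simp only at this
    rw [← this]
    field_simp
  have hS1 : ∀ h, S z h = 1 := by
    intro h
    simp only [S]
    rw [Finset.mul_sum, ← hF1 z h]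
    exact Finset.sum_congr rfl (fun x _ => hfix' h x)
  have hlamF : ∀ h x, lam z h x = F0 z h x := by
    intro h x
    rw [← hfix']
    simp [lam, hS1]
  refine ⟨lam z, fun h => ⟨hlam0 z hz h, hlam1 z h⟩, fun l Λ' h0 h1 => ?_⟩
  have hself := nash_lin Payoff (lam z) l (lam z l)
  rw [Function.update_eq_self] at hself
  rw [nash_lin, hself]
  have hle := nash_fix (lam z l) (V z l) (hlam1 z l) (hlamF l)
  calc ∑ x, Λ' x * nashV Payoff (lam z) l x
      ≤ ∑ x, Λ' x * ∑ y, lam z l y * V z l y :=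
        Finset.sum_le_sum (fun x _ => mul_le_mul_of_nonneg_left (hle x) (h0 x))
    _ = ∑ y, lam z l y * nashV Payoff (lam z) l y := by
        rw [← Finset.sum_mul, h1, one_mul]
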